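/- Let R > 0, P > 0, σ² > 0 and α > 0 be real constants. Let h be a random variable with exponential distribution of rate 1 and let X be a random point of ℝ² uniformly distributed on the closed disk of radius R centered at the origin, with h and X independent. Then E[log₂(1 + P ‖X‖^{−α} h / σ²)] = ∫₀^R ∫₀^∞ (e^{−s σ²} / ((s + P^{−1} r^{α}) · ln 2)) · (2r/R²) ds dr. -/

import Mathlib

open MeasureTheory ProbabilityTheory

lemma expMeasure_Ioi {r : ℝ} (hr : 0 < r) {x : ℝ} (hx : 0 ≤ x) :
    expMeasure r (Set.Ioi x) = ENNReal.ofReal (Real.exp (-(r * x))) := by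
  have := isProbabilityMeasure_expMeasure hr
  rw [← Set.compl_Iic, ← ofReal_measureReal, probReal_compl_eq_one_sub measurableSet_Iic,
    ← cdf_eq_real, cdf_expMeasure_eq hr, if_pos hx, sub_sub_cancel]

lemma ae_nonneg_expMeasure (r : ℝ) : ∀ᵐ x ∂(expMeasure r), 0 ≤ x := by
  rw [ae_iff, expMeasure, gammaMeasure]
  have : {x : ℝ | ¬ 0 ≤ x} = Set.Iio 0 := by ext; simp
  rw [this, withDensity_apply _ measurableSet_Iio]
  exact lintegral_gammaPDF_of_nonpos le_rfl

/-- Layer-cake evaluation of the mean of `log (1 + t / (b * A))` for exponential `t`. -/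
lemma lintegral_log_one_add_expMeasure {A b : ℝ} (hA : 0 < A) (hb : 0 < b) :
    ∫⁻ t, ENNReal.ofReal (Real.logb 2 (1 + t / b / A)) ∂(expMeasure 1)
      = ∫⁻ s in Set.Ioi (0 : ℝ),
          ENNReal.ofReal (Real.exp (-(s * b)) / ((s + A) * Real.log 2)) := by
  have hl : 0 < Real.log 2 := Real.log_pos one_lt_two
  have h0 := ae_nonneg_expMeasure 1
  have key := lintegral_comp_eq_lintegral_meas_lt_mul (expMeasure 1) (f := fun t ↦ t / b)
    (g := fun s ↦ 1 / ((s + A) * Real.log 2))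
    (by filter_upwards [h0] with t ht using div_nonneg ht hb.le) (by fun_prop)
    (fun t ht ↦ by
      refine ContinuousOn.intervalIntegrable ?_
      rw [Set.uIcc_of_le (le_of_lt ht)]
      refine ContinuousOn.div (by fun_prop) (by fun_prop) fun s hs ↦ ?_
      have := hs.1
      positivity)
    (by
      filter_upwards [ae_restrict_mem measurableSet_Ioi] with s hs
      have : 0 < s := hs
      positivity)
  calc _ = ∫⁻ t, ENNReal.ofReal (∫ s in (0 : ℝ)..(t / b), 1 / ((s + A) * Real.log 2))
        ∂(expMeasure 1) := by
        refine lintegral_congr_ae ?_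
        filter_upwards [h0] with t ht
        congr 1
        have htb : 0 ≤ t / b := div_nonneg ht hb.le
        simp_rw [one_div, mul_inv]
        rw [intervalIntegral.integral_mul_const,
          intervalIntegral.integral_comp_add_right (fun s : ℝ ↦ s⁻¹) A,
          integral_inv_of_pos (by linarith) (by linarith), Real.logb, div_eq_mul_inv]
        congr 2
        field_simp
        ring
    _ = _ := key
    _ = _ := by
        refine setLIntegral_congr_fun measurableSet_Ioi fun s hs ↦ ?_
        have hs' : 0 < s := hs
        have : {a : ℝ | s < a / b} = Set.Ioi (s * b) := by
          ext a; simp [lt_div_iff₀ hb]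
        simp only [this]
        rw [expMeasure_Ioi one_pos (by positivity), ← ENNReal.ofReal_mul (Real.exp_nonneg _)]
        congr 1
        rw [one_mul]
        ring

lemma integrableOn_exp_div_add {A b : ℝ} (hA : 0 < A) (hb : 0 < b) :
    IntegrableOn (fun s ↦ Real.exp (-(s * b)) / ((s + A) * Real.log 2)) (Set.Ioi (0 : ℝ)) := by
  have hl : 0 < Real.log 2 := Real.log_pos one_lt_two
  have hi : IntegrableOn (fun s ↦ Real.exp (-b * s) * (A * Real.log 2)⁻¹) (Set.Ioi (0 : ℝ)) :=
    (exp_neg_integrableOn_Ioi 0 hb).mul_const _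
  refine hi.mono' (Measurable.aestronglyMeasurable (by fun_prop)) ?_
  filter_upwards [ae_restrict_mem measurableSet_Ioi] with s hs
  have hs' : 0 < s := hs
  rw [Real.norm_of_nonneg (by positivity), div_eq_mul_inv,
    show -(s * b) = -b * s by ring]
  gcongr
  linarith

/-- Mean of a radial function over the uniform law on a planar disk. -/
lemma integral_norm_closedBall_fin_two (R : ℝ) (hR : 0 ≤ R) (G : ℝ → ℝ) :
    ∫ x in Metric.closedBall (0 : EuclideanSpace ℝ (Fin 2)) R, G ‖x‖
      = 2 * Real.pi * ∫ r in (0 : ℝ)..R, r * G r := by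
  have h1 : ∫ x in Metric.closedBall (0 : EuclideanSpace ℝ (Fin 2)) R, G ‖x‖
      = ∫ x : EuclideanSpace ℝ (Fin 2), (Set.Iic R).indicator G ‖x‖ := by
    rw [← integral_indicator Metric.isClosed_closedBall.measurableSet]
    congr 1 with x
    simp [Set.indicator]
  have h2 : volume.real (Metric.ball (0 : EuclideanSpace ℝ (Fin 2)) 1) = Real.pi := by
    rw [measureReal_def, EuclideanSpace.volume_ball_fin_two]
    simp [Real.pi_pos.le]
  rw [h1, integral_fun_norm_addHaar, h2, intervalIntegral.integral_of_le hR]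
  have h3 : ∫ y in Set.Ioi (0 : ℝ), y * (Set.Iic R).indicator G y
      = ∫ y in Set.Ioc 0 R, y * G y := by
    rw [← Set.Ioi_inter_Iic, ← setIntegral_indicator measurableSet_Iic]
    congr 1 with y
    simp [Set.indicator]
  simp [h3, mul_assoc]

/-- Interference-free instance of Proposition 1: for a user uniformly distributed on the
disk of radius `R`, Rayleigh fading `h ∼ exp(1)` independent of the position, power `P`,
path-loss exponent `α` and noise `σ²`,
`E[log₂(1 + P ‖X‖^{−α} h / σ²)]
  = ∫₀^R ∫₀^∞ (e^{−sσ²}/((s + P⁻¹ r^α) ln 2)) · (2r/R²) ds dr`. -/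
theorem expected_rate_uniform_disk {Ω : Type*} [MeasurableSpace Ω] (μ : Measure Ω)
    [IsProbabilityMeasure μ] (R P σ2 α : ℝ) (hR : 0 < R) (hP : 0 < P) (hσ2 : 0 < σ2)
    (hα : 0 < α) (h : Ω → ℝ) (X : Ω → EuclideanSpace ℝ (Fin 2))
    (hlawh : μ.map h = expMeasure 1)
    (hlawX : μ.map X = (ENNReal.ofReal (Real.pi * R ^ 2))⁻¹ •
      volume.restrict (Metric.closedBall (0 : EuclideanSpace ℝ (Fin 2)) R))
    (hindep : IndepFun h X μ) :
    ∫ ω, Real.logb 2 (1 + P * ‖X ω‖ ^ (-α) * h ω / σ2) ∂μ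
      = ∫ r in (0 : ℝ)..R,
          (∫ s in Set.Ioi (0 : ℝ),
            Real.exp (-(s * σ2)) / ((s + P⁻¹ * r ^ α) * Real.log 2)) * (2 * r / R ^ 2) := by
  have hl : 0 < Real.log 2 := Real.log_pos one_lt_two
  have hpe := isProbabilityMeasure_expMeasure (r := 1) one_pos
  have hh : AEMeasurable h μ := by
    refine AEMeasurable.of_map_ne_zero ?_
    rw [hlawh]
    exact IsProbabilityMeasure.ne_zero _
  have hX : AEMeasurable X μ := by
    refine AEMeasurable.of_map_ne_zero ?_
    rw [hlawX]
    intro h0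
    have h1 := congrArg (fun ν : Measure (EuclideanSpace ℝ (Fin 2)) ↦ ν Set.univ) h0
    simp [hR.not_ge, Real.pi_pos.not_ge] at h1
  set G : ℝ → ℝ := fun r ↦ ∫ s in Set.Ioi (0 : ℝ),
    Real.exp (-(s * σ2)) / ((s + P⁻¹ * r ^ α) * Real.log 2) with hG
  have hGm : StronglyMeasurable G := by
    refine StronglyMeasurable.integral_prod_right
      (f := fun r s : ℝ ↦ Real.exp (-(s * σ2)) / ((s + P⁻¹ * r ^ α) * Real.log 2)) ?_
    refine Measurable.stronglyMeasurable ?_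
    simp only [Function.uncurry_def]
    fun_prop
  have hG0 : ∀ r, 0 ≤ r → 0 ≤ G r := fun r hr ↦
    setIntegral_nonneg measurableSet_Ioi fun s hs ↦ by
      have : 0 < s := hs
      positivity
  have hprob : IsProbabilityMeasure (μ.map X) := Measure.isProbabilityMeasure_map hX
  let L : ℝ × EuclideanSpace ℝ (Fin 2) → ℝ :=
    fun p ↦ Real.logb 2 (1 + P * ‖p.2‖ ^ (-α) * p.1 / σ2)
  have hLm : Measurable L := by
    simp only [L, Real.logb]
    fun_prop
  have hpair : μ.map (fun ω ↦ (h ω, X ω)) = (expMeasure 1).prod (μ.map X) := by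
    rw [← hlawh]
    exact (indepFun_iff_map_prod_eq_prod_map_map hh hX).1 hindep
  have hX0 : ∀ᵐ x ∂(μ.map X), x ≠ 0 := by
    rw [hlawX]
    refine Measure.ae_smul_measure (ae_restrict_of_ae ?_) _
    simp [ae_iff]
  have hh0 : ∀ᵐ ω ∂μ, 0 ≤ h ω := by
    refine ae_of_ae_map hh ?_
    rw [hlawh]
    exact ae_nonneg_expMeasure 1
  have hinner : ∀ x : EuclideanSpace ℝ (Fin 2), x ≠ 0 →
      ∫⁻ t, ENNReal.ofReal (L (t, x)) ∂(expMeasure 1) = ENNReal.ofReal (G ‖x‖) := by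
    intro x hx
    have hn : 0 < ‖x‖ := norm_pos_iff.2 hx
    have hA : 0 < P⁻¹ * ‖x‖ ^ α := by positivity
    rw [hG, ofReal_integral_eq_lintegral_ofReal (integrableOn_exp_div_add hA hσ2),
      ← lintegral_log_one_add_expMeasure hA hσ2]
    · refine lintegral_congr fun t ↦ ?_
      simp only [L]
      rw [Real.rpow_neg hn.le]
      congr 3
      field_simp
    · filter_upwards [ae_restrict_mem measurableSet_Ioi] with s hs
      have : 0 < s := hs
      positivity
  have hE : ∫ ω, Real.logb 2 (1 + P * ‖X ω‖ ^ (-α) * h ω / σ2) ∂μ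
      = ∫ x, G ‖x‖ ∂(μ.map X) := by
    rw [integral_eq_lintegral_of_nonneg_ae, integral_eq_lintegral_of_nonneg_ae]
    · congr 1
      calc _ = ∫⁻ p, ENNReal.ofReal (L p) ∂(μ.map (fun ω ↦ (h ω, X ω))) :=
            (lintegral_map' (by fun_prop) (hh.prodMk hX)).symm
        _ = ∫⁻ x, ∫⁻ t, ENNReal.ofReal (L (t, x)) ∂(expMeasure 1) ∂(μ.map X) := by
            rw [hpair, lintegral_prod_symm' _ (by fun_prop)]
        _ = _ := by
            refine lintegral_congr_ae ?_
            filter_upwards [hX0] with x hx using hinner x hx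
    · exact .of_forall fun x ↦ hG0 _ (norm_nonneg _)
    · exact (hGm.comp_measurable measurable_norm).aestronglyMeasurable
    · filter_upwards [hh0] with ω hω
      refine Real.logb_nonneg one_lt_two ?_
      have : 0 ≤ P * ‖X ω‖ ^ (-α) * h ω / σ2 := by positivity
      linarith
    · exact (hLm.comp_aemeasurable (hh.prodMk hX)).aestronglyMeasurable
  rw [hE, hlawX, integral_smul_measure, integral_norm_closedBall_fin_two R hR.le,
    ENNReal.toReal_inv, ENNReal.toReal_ofReal (by positivity), smul_eq_mul, ← mul_assoc,
    ← intervalIntegral.integral_const_mul]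
  refine intervalIntegral.integral_congr fun r _ ↦ ?_
  have := Real.pi_pos
  change _ = G r * (2 * r / R ^ 2)
  field_simp
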